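/- arXiv:1602.04314 — 5 statements merged into one kernel-verified Lean document; each statement's English description precedes it below -/
import Mathlib

section
/- In the integral group algebra ℤ[D] of the dihedral group D of order 10, with s, t, a, b, c as defined in the context, the following identities hold: a·a = 2a, a·b = 2b, b·a = 2b, and b·b = 2a + 2b + 2c. -/
open DihedralGroup

/-- In `ℤ[D₁₀]` (dihedral group of order 10), with
`a = e̲ + s̲` (i.e. `s̲` in KL-notation is `a := e + s`),
`b := e + s + t + st + ts + sts` and `c` the sum of all ten group elements,
one has `a·a = 2a`, `a·b = 2b`, `b·a = 2b`, `b·b = 2a + 2b + 2c`. -/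
theorem stmt_2 (a b c : MonoidAlgebra ℤ (DihedralGroup 5))
    (ha : a = MonoidAlgebra.of ℤ (DihedralGroup 5) 1
            + MonoidAlgebra.of ℤ (DihedralGroup 5) (sr 0))
    (hb : b = MonoidAlgebra.of ℤ (DihedralGroup 5) 1
            + MonoidAlgebra.of ℤ (DihedralGroup 5) (sr 0)
            + MonoidAlgebra.of ℤ (DihedralGroup 5) (sr 1)
            + MonoidAlgebra.of ℤ (DihedralGroup 5) (sr 0 * sr 1)
            + MonoidAlgebra.of ℤ (DihedralGroup 5) (sr 1 * sr 0)
            + MonoidAlgebra.of ℤ (DihedralGroup 5) (sr 0 * sr 1 * sr 0))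
    (hc : c = ∑ g : DihedralGroup 5, MonoidAlgebra.of ℤ (DihedralGroup 5) g) :
    a * a = 2 * a ∧ a * b = 2 * b ∧ b * a = 2 * b ∧ b * b = 2 * a + 2 * b + 2 * c := by
  have univ_eq : (Finset.univ : Finset (DihedralGroup 5)) =
      {r 0, r 1, r 2, r 3, r 4, sr 0, sr 1, sr 2, sr 3, sr 4} := by decide
  have one_add_four : (1 + 4 : ZMod 5) = 0 := by decide
  have four_add_one : (4 + 1 : ZMod 5) = 0 := by decide
  have one_add_one : (1 + 1 : ZMod 5) = 2 := by decide
  have four_add_four : (4 + 4 : ZMod 5) = 3 := by decide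
  have neg_one : (-1 : ZMod 5) = 4 := by decide
  have neg_four : (-4 : ZMod 5) = 1 := by decide
  have four_sub_one : (4 - 1 : ZMod 5) = 3 := by decide
  have one_sub_four : (1 - 4 : ZMod 5) = 2 := by decide
  have hc' : c = MonoidAlgebra.of ℤ _ (r 0) + MonoidAlgebra.of ℤ _ (r 1)
      + MonoidAlgebra.of ℤ _ (r 2) + MonoidAlgebra.of ℤ _ (r 3) + MonoidAlgebra.of ℤ _ (r 4)
      + MonoidAlgebra.of ℤ _ (sr 0) + MonoidAlgebra.of ℤ _ (sr 1) + MonoidAlgebra.of ℤ _ (sr 2)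
      + MonoidAlgebra.of ℤ _ (sr 3) + MonoidAlgebra.of ℤ _ (sr 4) := by
    rw [hc, univ_eq]
    repeat rw [Finset.sum_insert (by decide)]
    rw [Finset.sum_singleton]
    abel
  subst ha hb hc'
  refine ⟨?_, ?_, ?_, ?_⟩ <;>
  · simp only [two_mul, mul_add, add_mul, ← map_mul, one_def, r_mul_r, r_mul_sr, sr_mul_r,
      sr_mul_sr, add_zero, zero_add, sub_zero, zero_sub, sub_self, one_add_four, four_add_one,
      one_add_one, four_add_four, neg_one, neg_four, four_sub_one, one_sub_four]
    abel
end

section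
/- The ℂ-algebra A₅ := ℂ[X,Y]/(X² − 2X, XY − 2Y, Y² − 2X − 2Y) is isomorphic, as a ℂ-algebra, to ℂ × ℂ × ℂ; in particular A₅ is a commutative split semisimple ℂ-algebra of dimension 3. -/
open MvPolynomial

/-- If `1` is a sum of simultaneous eigenvectors `e j` of multiplication by the `x i`, with
eigenvalues `v j i`, then evaluation at `x` expands as a combination of evaluations at the `v j`. -/
theorem aeval_eq_sum_eval_smul {R A σ ι : Type*} [CommRing R] [CommRing A]
    [Algebra R A] [Fintype ι] (x : σ → A) (v : ι → σ → R) (e : ι → A) (he : ∑ j, e j = 1)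
    (hx : ∀ i j, x i * e j = v j i • e j) (p : MvPolynomial σ R) :
    aeval x p = ∑ j, eval (v j) p • e j := by
  induction p using MvPolynomial.induction_on with
  | C a => simp [← Finset.smul_sum, he, Algebra.algebraMap_eq_smul_one]
  | add p q hp hq => simp [hp, hq, add_smul, Finset.sum_add_distrib]
  | mul_X p i hp =>
    rw [map_mul, aeval_X, hp, Finset.sum_mul]
    refine Finset.sum_congr rfl fun j _ => ?_
    rw [smul_mul_assoc, mul_comm, hx, smul_smul, map_mul, eval_X]

/-- The common zeros of `X² − 2X`, `XY − 2Y` and `Y² − 2X − 2Y`, where `s` is a square root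
of `5`. -/
noncomputable def commonZero (s : ℂ) : Fin 3 → Fin 2 → ℂ := ![![0, 0], ![2, 1 + s], ![2, 1 - s]]

/-- The combinations of `1`, `x`, `y` which interpolate the indicator functions of the points of
`commonZero s`. -/
noncomputable def interpolant {A : Type*} [CommRing A] [Algebra ℂ A] (s : ℂ) (x : Fin 2 → A) :
    Fin 3 → A :=
  ![1 - (1 / 2 : ℂ) • x 0, (s / 10) • x 1 + ((5 - s) / 20) • x 0,
    (-s / 10) • x 1 + ((5 + s) / 20) • x 0]

theorem map_interpolant {A B : Type*} [CommRing A] [Algebra ℂ A] [CommRing B] [Algebra ℂ B]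
    (f : A →ₐ[ℂ] B) (s : ℂ) (x : Fin 2 → A) (j : Fin 3) :
    f (interpolant s x j) = interpolant s (fun i => f (x i)) j := by
  fin_cases j <;> simp [interpolant]

theorem sum_interpolant {A : Type*} [CommRing A] [Algebra ℂ A] (s : ℂ) (x : Fin 2 → A) :
    ∑ j, interpolant s x j = 1 := by
  simp only [Fin.sum_univ_three, interpolant, Matrix.cons_val]
  module

theorem mul_interpolant {A : Type*} [CommRing A] [Algebra ℂ A] {s : ℂ} (hs : s ^ 2 = 5)
    {x : Fin 2 → A} (hxx : x 0 * x 0 = (2 : ℂ) • x 0) (hxy : x 0 * x 1 = (2 : ℂ) • x 1)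
    (hyy : x 1 * x 1 = (2 : ℂ) • x 0 + (2 : ℂ) • x 1) (i : Fin 2) (j : Fin 3) :
    x i * interpolant s x j = commonZero s j i • interpolant s x j := by
  have hyx : x 1 * x 0 = (2 : ℂ) • x 1 := by rw [mul_comm, hxy]
  fin_cases i <;> fin_cases j <;>
    simp only [Fin.zero_eta, Fin.mk_one, Fin.reduceFinMk, interpolant, commonZero,
      Matrix.cons_val, mul_add, mul_sub, mul_smul_comm, mul_one, hxx, hxy, hyx, hyy] <;>
    match_scalars <;> grind

theorem interpolant_commonZero {s : ℂ} (hs : s ^ 2 = 5) (i j : Fin 3) :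
    interpolant s (commonZero s i) j = if i = j then 1 else 0 := by
  fin_cases i <;> fin_cases j <;> simp [interpolant, commonZero] <;> grind

/-- The ℂ-algebra `A₅ = ℂ[X,Y]/(X² − 2X, XY − 2Y, Y² − 2X − 2Y)` is
isomorphic as a ℂ-algebra to `ℂ × ℂ × ℂ`; in particular it is a commutative split
semisimple ℂ-algebra of dimension 3. -/
theorem stmt_3 (I : Ideal (MvPolynomial (Fin 2) ℂ))
    (hI : I = Ideal.span
      {X 0 ^ 2 - 2 * X 0, X 0 * X 1 - 2 * X 1, X 1 ^ 2 - 2 * X 0 - 2 * X 1}) :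
    Nonempty ((MvPolynomial (Fin 2) ℂ ⧸ I) ≃ₐ[ℂ] ℂ × ℂ × ℂ) ∧
    Module.finrank ℂ (MvPolynomial (Fin 2) ℂ ⧸ I) = 3 := by
  obtain ⟨s, hs⟩ : ∃ s : ℂ, s ^ 2 = 5 := IsAlgClosed.exists_pow_nat_eq 5 two_pos
  let φ : MvPolynomial (Fin 2) ℂ →ₐ[ℂ] ℂ × ℂ × ℂ :=
    (aeval (commonZero s 0)).prod ((aeval (commonZero s 1)).prod (aeval (commonZero s 2)))
  have hφ : ∀ p ∈ I, φ p = 0 := by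
    suffices I ≤ RingHom.ker φ from fun p hp => this hp
    rw [hI, Ideal.span_le]
    rintro p (rfl | rfl | rfl) <;>
      simp only [SetLike.mem_coe, RingHom.mem_ker, φ, AlgHom.prod_apply, map_sub, map_mul,
        map_pow, map_ofNat, aeval_X, commonZero, Matrix.cons_val] <;>
      ext <;> simp <;> grind
  let f := Ideal.Quotient.liftₐ I φ hφ
  let π : MvPolynomial (Fin 2) ℂ →ₐ[ℂ] MvPolynomial (Fin 2) ℂ ⧸ I := Ideal.Quotient.mkₐ ℂ I
  have hπ : ∀ p ∈ I, π p = 0 := fun p hp => Ideal.Quotient.eq_zero_iff_mem.2 hp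
  have hxx : π (X 0) * π (X 0) = (2 : ℂ) • π (X 0) := by
    have h := hπ (X 0 ^ 2 - 2 * X 0) (hI ▸ Ideal.subset_span (by simp))
    rwa [sq, two_mul, map_sub, map_mul, map_add, ← two_smul ℂ, sub_eq_zero] at h
  have hxy : π (X 0) * π (X 1) = (2 : ℂ) • π (X 1) := by
    have h := hπ (X 0 * X 1 - 2 * X 1) (hI ▸ Ideal.subset_span (by simp))
    rwa [two_mul, map_sub, map_mul, map_add, ← two_smul ℂ, sub_eq_zero] at h
  have hyy : π (X 1) * π (X 1) = (2 : ℂ) • π (X 0) + (2 : ℂ) • π (X 1) := by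
    have h := hπ (X 1 ^ 2 - 2 * X 0 - 2 * X 1) (hI ▸ Ideal.subset_span (by simp))
    rwa [sq, two_mul, two_mul, map_sub, map_sub, map_mul, map_add, map_add, ← two_smul ℂ,
      ← two_smul ℂ (π (X 1)), sub_sub, sub_eq_zero] at h
  let E : Fin 3 → MvPolynomial (Fin 2) ℂ := interpolant s X
  have hexp (p : MvPolynomial (Fin 2) ℂ) : π p = ∑ j, aeval (commonZero s j) p • π (E j) := by
    simp only [E, map_interpolant]
    refine .trans ?_ (aeval_eq_sum_eval_smul (fun i => π (X i)) (commonZero s) _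
      (sum_interpolant s _) (mul_interpolant hs hxx hxy hyy) p)
    rw [← comp_aeval_apply, aeval_X_left_apply]
  have hE (i j : Fin 3) : aeval (commonZero s i) (E j) = if i = j then 1 else 0 := by
    simp only [E, map_interpolant, aeval_X, interpolant_commonZero hs]
  have hf : Function.Bijective f := by
    constructor
    · rw [injective_iff_map_eq_zero]
      intro q hq
      obtain ⟨p, rfl⟩ := Ideal.Quotient.mk_surjective q
      have hp : φ p = 0 := hq
      simp only [φ, AlgHom.prod_apply, Prod.mk_eq_zero] at hp
      change π p = 0
      rw [hexp, Fin.sum_univ_three, hp.1, hp.2.1, hp.2.2]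
      simp
    · rintro ⟨a, b, c⟩
      refine ⟨π (a • E 0 + b • E 1 + c • E 2), ?_⟩
      change φ _ = _
      simp only [φ, AlgHom.prod_apply, map_add, map_smul, hE]
      simp
  let g := AlgEquiv.ofBijective f hf
  refine ⟨⟨g⟩, ?_⟩
  rw [g.toLinearEquiv.finrank_eq]
  simp
end

section
/- The ℂ-algebra A₄ := ℂ[X,Y]/(X² − 2X, XY − 2Y, Y² − 2X) is isomorphic, as a ℂ-algebra, to ℂ × ℂ × ℂ; in particular A₄ is a commutative split semisimple ℂ-algebra of dimension 3. -/
open MvPolynomial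

/-- The algebra homomorphism from `R × R × R` determined by three orthogonal idempotents of sum
`1`. -/
def AlgHom.ofOrthogonalIdempotents₃ {R A : Type*} [CommSemiring R] [CommSemiring A] [Algebra R A]
    (e₁ e₂ e₃ : A) (h₁ : e₁ * e₁ = e₁) (h₂ : e₂ * e₂ = e₂) (h₃ : e₃ * e₃ = e₃)
    (h₁₂ : e₁ * e₂ = 0) (h₁₃ : e₁ * e₃ = 0) (h₂₃ : e₂ * e₃ = 0) (h : e₁ + e₂ + e₃ = 1) :
    R × R × R →ₐ[R] A :=
  AlgHom.ofLinearMap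
    { toFun := fun v => v.1 • e₁ + v.2.1 • e₂ + v.2.2 • e₃
      map_add' := fun v w => by simp only [Prod.fst_add, Prod.snd_add, add_smul]; ring
      map_smul' := fun r v => by simp [mul_smul] }
    (by simpa using h)
    (fun v w => by
      have h₂₁ : e₂ * e₁ = 0 := mul_comm e₂ e₁ ▸ h₁₂
      have h₃₁ : e₃ * e₁ = 0 := mul_comm e₃ e₁ ▸ h₁₃
      have h₃₂ : e₃ * e₂ = 0 := mul_comm e₃ e₂ ▸ h₂₃
      simp [mul_add, add_mul, h₁, h₂, h₃, h₁₂, h₁₃, h₂₃, h₂₁, h₃₁, h₃₂, mul_comm v.1,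
        mul_comm v.2.1, mul_comm v.2.2, mul_smul])

@[simp]
theorem AlgHom.ofOrthogonalIdempotents₃_apply {R A : Type*} [CommSemiring R] [CommSemiring A]
    [Algebra R A] (e₁ e₂ e₃ : A) (h₁ : e₁ * e₁ = e₁) (h₂ : e₂ * e₂ = e₂) (h₃ : e₃ * e₃ = e₃)
    (h₁₂ : e₁ * e₂ = 0) (h₁₃ : e₁ * e₃ = 0) (h₂₃ : e₂ * e₃ = 0) (h : e₁ + e₂ + e₃ = 1)
    (v : R × R × R) :
    AlgHom.ofOrthogonalIdempotents₃ e₁ e₂ e₃ h₁ h₂ h₃ h₁₂ h₁₃ h₂₃ h v =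
      v.1 • e₁ + v.2.1 • e₂ + v.2.2 • e₃ :=
  rfl

/-- The ℂ-algebra `A₄ = ℂ[X,Y]/(X² − 2X, XY − 2Y, Y² − 2X)` is
isomorphic as a ℂ-algebra to `ℂ × ℂ × ℂ`; in particular it is a commutative split
semisimple ℂ-algebra of dimension 3. -/
theorem stmt_5 (I : Ideal (MvPolynomial (Fin 2) ℂ))
    (hI : I = Ideal.span
      {X 0 ^ 2 - 2 * X 0, X 0 * X 1 - 2 * X 1, X 1 ^ 2 - 2 * X 0}) :
    Nonempty ((MvPolynomial (Fin 2) ℂ ⧸ I) ≃ₐ[ℂ] ℂ × ℂ × ℂ) ∧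
    Module.finrank ℂ (MvPolynomial (Fin 2) ℂ ⧸ I) = 3 := by
  suffices hne : Nonempty ((MvPolynomial (Fin 2) ℂ ⧸ I) ≃ₐ[ℂ] ℂ × ℂ × ℂ) by
    obtain ⟨e⟩ := hne
    exact ⟨⟨e⟩, by simp [e.toLinearEquiv.finrank_eq]⟩
  let x : MvPolynomial (Fin 2) ℂ ⧸ I := Ideal.Quotient.mkₐ ℂ I (X 0)
  let y : MvPolynomial (Fin 2) ℂ ⧸ I := Ideal.Quotient.mkₐ ℂ I (X 1)
  have mk_zero {p : MvPolynomial (Fin 2) ℂ} (hp : p ∈ I) : Ideal.Quotient.mkₐ ℂ I p = 0 :=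
    Ideal.Quotient.eq_zero_iff_mem.mpr hp
  have hxx : x ^ 2 - 2 * x = 0 :=
    mk_zero (p := X 0 ^ 2 - 2 * X 0) (hI ▸ Ideal.subset_span (by simp))
  have hxy : x * y - 2 * y = 0 :=
    mk_zero (p := X 0 * X 1 - 2 * X 1) (hI ▸ Ideal.subset_span (by simp))
  have hyy : y ^ 2 - 2 * x = 0 :=
    mk_zero (p := X 1 ^ 2 - 2 * X 0) (hI ▸ Ideal.subset_span (by simp))
  obtain ⟨t, ht⟩ : ∃ t : MvPolynomial (Fin 2) ℂ ⧸ I, t = algebraMap ℂ _ (1 / 2) := ⟨_, rfl⟩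
  have ht2 : 2 * t = 1 := by
    rw [ht, ← map_ofNat (algebraMap ℂ (MvPolynomial (Fin 2) ℂ ⧸ I)) 2, ← map_mul]
    norm_num
  let φ : MvPolynomial (Fin 2) ℂ →ₐ[ℂ] ℂ × ℂ × ℂ := aeval ![(0, 2, 2), (0, 2, -2)]
  have hφ : ∀ p ∈ I, φ p = 0 := by
    suffices I ≤ RingHom.ker φ from fun p hp => this hp
    rw [hI, Ideal.span_le]
    rintro p (rfl | rfl | rfl) <;>
      ext <;> simp [φ] <;> norm_num
  let f := Ideal.Quotient.liftₐ I φ hφ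
  have hfx : f x = (0, 2, 2) := by
    change φ (X 0) = _
    simp [φ]
  have hfy : f y = (0, 2, -2) := by
    change φ (X 1) = _
    simp [φ]
  have hft : f t = (1 / 2, 1 / 2, 1 / 2) := by
    rw [ht, AlgHom.commutes]
    rfl
  let g : ℂ × ℂ × ℂ →ₐ[ℂ] MvPolynomial (Fin 2) ℂ ⧸ I :=
    AlgHom.ofOrthogonalIdempotents₃ (1 - t * x) (t * t * (x + y)) (t * t * (x - y))
      (by grind) (by grind) (by grind) (by grind) (by grind) (by grind) (by grind)
  refine ⟨AlgEquiv.ofAlgHom f g ?_ ?_⟩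
  · refine AlgHom.ext fun v => ?_
    simp only [g, AlgHom.comp_apply, AlgHom.ofOrthogonalIdempotents₃_apply, map_add, map_smul,
      map_sub, map_mul, map_one, hfx, hfy, hft]
    ext <;> simp <;> ring
  · refine Ideal.Quotient.algHom_ext _ (MvPolynomial.algHom_ext fun i => ?_)
    fin_cases i
    · change g (f x) = x
      simp only [hfx, g, AlgHom.ofOrthogonalIdempotents₃_apply, Algebra.smul_def, map_ofNat,
        map_zero]
      grind
    · change g (f y) = y
      simp only [hfy, g, AlgHom.ofOrthogonalIdempotents₃_apply, Algebra.smul_def, map_ofNat,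
        map_zero, map_neg]
      grind
end

section
/- The ℂ-algebra A₄ := ℂ[X,Y]/(X² − 2X, XY − 2Y, Y² − 2X) has exactly three ℂ-algebra homomorphisms to ℂ. Writing x and y for the classes of X and Y, every ℂ-algebra homomorphism φ : A₄ → ℂ satisfies (φ(x), φ(y)) ∈ {(0,0), (2,−2), (2,2)}, and each of these three pairs of values is attained by exactly one such homomorphism. -/
open MvPolynomial

/-- Relations of `A₄` evaluated in `ℂ` have exactly the three solutions listed. -/
lemma eq_or_eq_or_eq_of_relations {a b : ℂ} (h₁ : a ^ 2 - 2 * a = 0)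
    (h₂ : a * b - 2 * b = 0) (h₃ : b ^ 2 - 2 * a = 0) :
    (a, b) = (0, 0) ∨ (a, b) = (2, -2) ∨ (a, b) = (2, 2) := by
  simp only [Prod.mk.injEq]
  have ha : a * (a - 2) = 0 := by linear_combination h₁
  rcases mul_eq_zero.mp ha with rfl | ha
  · have hb : b ^ 2 = 0 := by linear_combination h₃
    exact Or.inl ⟨rfl, by simpa using hb⟩
  · obtain rfl : a = 2 := sub_eq_zero.mp ha
    have hb : (b + 2) * (b - 2) = 0 := by linear_combination h₃
    rcases mul_eq_zero.mp hb with hb | hb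
    · exact Or.inr (Or.inl ⟨rfl, eq_neg_of_add_eq_zero_left hb⟩)
    · exact Or.inr (Or.inr ⟨rfl, sub_eq_zero.mp hb⟩)

/-- The ℂ-algebra `A₄ = ℂ[X,Y]/(X² − 2X, XY − 2Y, Y² − 2X)` has
exactly three ℂ-algebra homomorphisms to ℂ; every such homomorphism `φ` satisfies
`(φ x, φ y) ∈ {(0,0), (2,−2), (2,2)}` (where `x`, `y` are the classes of
`X`, `Y`), and each of these three pairs of values is attained by exactly one
homomorphism. -/
theorem stmt_6 (I : Ideal (MvPolynomial (Fin 2) ℂ))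
    (hI : I = Ideal.span
      {X 0 ^ 2 - 2 * X 0, X 0 * X 1 - 2 * X 1, X 1 ^ 2 - 2 * X 0})
    (x y : MvPolynomial (Fin 2) ℂ ⧸ I)
    (hx : x = Ideal.Quotient.mk I (X 0)) (hy : y = Ideal.Quotient.mk I (X 1)) :
    Nat.card ((MvPolynomial (Fin 2) ℂ ⧸ I) →ₐ[ℂ] ℂ) = 3 ∧
    (∀ φ : (MvPolynomial (Fin 2) ℂ ⧸ I) →ₐ[ℂ] ℂ,
      (φ x, φ y) = (0, 0) ∨
      (φ x, φ y) = (2, -2) ∨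
      (φ x, φ y) = (2, 2)) ∧
    (∃! φ : (MvPolynomial (Fin 2) ℂ ⧸ I) →ₐ[ℂ] ℂ, φ x = 0 ∧ φ y = 0) ∧
    (∃! φ : (MvPolynomial (Fin 2) ℂ ⧸ I) →ₐ[ℂ] ℂ,
      φ x = 2 ∧ φ y = -2) ∧
    (∃! φ : (MvPolynomial (Fin 2) ℂ ⧸ I) →ₐ[ℂ] ℂ,
      φ x = 2 ∧ φ y = 2) := by
  subst hx hy
  have hext (φ ψ : (MvPolynomial (Fin 2) ℂ ⧸ I) →ₐ[ℂ] ℂ)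
      (h₀ : φ (Ideal.Quotient.mk I (X 0)) = ψ (Ideal.Quotient.mk I (X 0)))
      (h₁ : φ (Ideal.Quotient.mk I (X 1)) = ψ (Ideal.Quotient.mk I (X 1))) : φ = ψ := by
    apply Ideal.Quotient.algHom_ext
    apply MvPolynomial.algHom_ext
    intro i
    fin_cases i
    · exact h₀
    · exact h₁
  have hexists (a b : ℂ) (h₁ : a ^ 2 - 2 * a = 0) (h₂ : a * b - 2 * b = 0)
      (h₃ : b ^ 2 - 2 * a = 0) : ∃ φ : (MvPolynomial (Fin 2) ℂ ⧸ I) →ₐ[ℂ] ℂ,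
      φ (Ideal.Quotient.mk I (X 0)) = a ∧ φ (Ideal.Quotient.mk I (X 1)) = b := by
    have hle : I ≤ RingHom.ker (aeval ![a, b] : MvPolynomial (Fin 2) ℂ →ₐ[ℂ] ℂ) := by
      rw [hI, Ideal.span_le]
      rintro p (rfl | rfl | rfl) <;> simpa [RingHom.mem_ker]
    refine ⟨Ideal.Quotient.liftₐ I (aeval ![a, b]) fun p hp => hle hp, ?_, ?_⟩
    · exact (aeval_X ![a, b] 0)
    · exact (aeval_X ![a, b] 1)
  have hunique (a b : ℂ) (h₁ : a ^ 2 - 2 * a = 0) (h₂ : a * b - 2 * b = 0)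
      (h₃ : b ^ 2 - 2 * a = 0) : ∃! φ : (MvPolynomial (Fin 2) ℂ ⧸ I) →ₐ[ℂ] ℂ,
      φ (Ideal.Quotient.mk I (X 0)) = a ∧ φ (Ideal.Quotient.mk I (X 1)) = b := by
    obtain ⟨φ, hφ⟩ := hexists a b h₁ h₂ h₃
    exact ⟨φ, hφ, fun ψ hψ => hext ψ φ (hψ.1.trans hφ.1.symm) (hψ.2.trans hφ.2.symm)⟩
  have hvalues (φ : (MvPolynomial (Fin 2) ℂ ⧸ I) →ₐ[ℂ] ℂ) :
      (φ (Ideal.Quotient.mk I (X 0)), φ (Ideal.Quotient.mk I (X 1))) = (0, 0) ∨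
      (φ (Ideal.Quotient.mk I (X 0)), φ (Ideal.Quotient.mk I (X 1))) = (2, -2) ∨
      (φ (Ideal.Quotient.mk I (X 0)), φ (Ideal.Quotient.mk I (X 1))) = (2, 2) := by
    have hzero (p : MvPolynomial (Fin 2) ℂ) (hp : p ∈ ({X 0 ^ 2 - 2 * X 0,
        X 0 * X 1 - 2 * X 1, X 1 ^ 2 - 2 * X 0} : Set (MvPolynomial (Fin 2) ℂ))) :
        φ.comp (Ideal.Quotient.mkₐ ℂ I) p = 0 := by
      change φ (Ideal.Quotient.mk I p) = 0
      rw [Ideal.Quotient.eq_zero_iff_mem.mpr (hI ▸ Ideal.subset_span hp), map_zero]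
    change (φ.comp (Ideal.Quotient.mkₐ ℂ I) (X 0), φ.comp (Ideal.Quotient.mkₐ ℂ I) (X 1)) = _ ∨
      (φ.comp (Ideal.Quotient.mkₐ ℂ I) (X 0), φ.comp (Ideal.Quotient.mkₐ ℂ I) (X 1)) = _ ∨
      (φ.comp (Ideal.Quotient.mkₐ ℂ I) (X 0), φ.comp (Ideal.Quotient.mkₐ ℂ I) (X 1)) = _
    generalize φ.comp (Ideal.Quotient.mkₐ ℂ I) = ψ at hzero ⊢
    apply eq_or_eq_or_eq_of_relations
    · have h := hzero (X 0 ^ 2 - 2 * X 0) (by simp)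
      rwa [map_sub, map_pow, map_mul, map_ofNat] at h
    · have h := hzero (X 0 * X 1 - 2 * X 1) (by simp)
      rwa [map_sub, map_mul, map_mul, map_ofNat] at h
    · have h := hzero (X 1 ^ 2 - 2 * X 0) (by simp)
      rwa [map_sub, map_pow, map_mul, map_ofNat] at h
  have h₀ := hunique 0 0 (by norm_num) (by norm_num) (by norm_num)
  have h₁ := hunique 2 (-2) (by norm_num) (by norm_num) (by norm_num)
  have h₂ := hunique 2 2 (by norm_num) (by norm_num) (by norm_num)
  refine ⟨?_, hvalues, h₀, h₁, h₂⟩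
  obtain ⟨φ₀, hφ₀, -⟩ := h₀
  obtain ⟨φ₁, hφ₁, -⟩ := h₁
  obtain ⟨φ₂, hφ₂, -⟩ := h₂
  have huniv : (Set.univ : Set ((MvPolynomial (Fin 2) ℂ ⧸ I) →ₐ[ℂ] ℂ)) = {φ₀, φ₁, φ₂} := by
    refine (Set.eq_univ_of_forall fun φ => ?_).symm
    simp only [Set.mem_insert_iff, Set.mem_singleton_iff]
    refine (hvalues φ).imp (fun h => ?_) (Or.imp (fun h => ?_) fun h => ?_) <;>
      rw [Prod.mk.injEq] at h <;> apply hext <;> simp only [h, hφ₀, hφ₁, hφ₂]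
  rw [← Set.ncard_univ, huniv, Set.ncard_eq_three]
  refine ⟨φ₀, φ₁, φ₂, ?_, ?_, ?_, rfl⟩
  · rintro rfl
    exact two_ne_zero (hφ₁.1.symm.trans hφ₀.1)
  · rintro rfl
    exact two_ne_zero (hφ₂.1.symm.trans hφ₀.1)
  · rintro rfl
    have h := hφ₁.2.symm.trans hφ₂.2
    norm_num at h
end

section
/- Let N = [[a,b],[c,d]] be a 2×2 matrix with nonnegative integer entries such that N·N = 2·N + 4·I (where I is the identity matrix) and both off-diagonal entries satisfy b > 0 and c > 0. Then N is one of the following eight matrices: [[1,1],[5,1]], [[1,5],[1,1]], [[0,4],[1,2]], [[0,2],[2,2]], [[0,1],[4,2]], [[2,4],[1,0]], [[2,2],[2,0]], [[2,1],[4,0]]. Equivalently: a + d = 2, and either (a,d) = (1,1) with b·c = 5, or {a,d} = {0,2} with b·c = 4. -/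
/-- A 2×2 matrix `N = [[a,b],[c,d]]` with nonnegative integer entries
satisfying `N·N = 2·N + 4·I` and `b > 0`, `c > 0` is one of the eight listed
matrices; equivalently `a + d = 2` and either `(a,d) = (1,1)` with `b·c = 5`, or
`{a,d} = {0,2}` with `b·c = 4`. -/
theorem stmt_8 (N : Matrix (Fin 2) (Fin 2) ℕ)
    (hN : N * N = 2 • N + 4 • (1 : Matrix (Fin 2) (Fin 2) ℕ))
    (hb : 0 < N 0 1) (hc : 0 < N 1 0) :
    (N = !![1, 1; 5, 1] ∨ N = !![1, 5; 1, 1] ∨ N = !![0, 4; 1, 2] ∨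
     N = !![0, 2; 2, 2] ∨ N = !![0, 1; 4, 2] ∨ N = !![2, 4; 1, 0] ∨
     N = !![2, 2; 2, 0] ∨ N = !![2, 1; 4, 0]) ∧
    N 0 0 + N 1 1 = 2 ∧
    ((N 0 0 = 1 ∧ N 1 1 = 1 ∧ N 0 1 * N 1 0 = 5) ∨
     ((N 0 0 = 0 ∧ N 1 1 = 2 ∨ N 0 0 = 2 ∧ N 1 1 = 0) ∧ N 0 1 * N 1 0 = 4)) := by
  obtain ⟨a, b, c, d, rfl⟩ : ∃ a b c d, N = !![a, b; c, d] :=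
    ⟨_, _, _, _, Matrix.eta_fin_two N⟩
  have h00 := congrFun (congrFun hN 0) 0
  have h01 := congrFun (congrFun hN 0) 1
  simp [Matrix.mul_apply, Fin.sum_univ_two, Matrix.ofNat_apply] at h00 h01 hb hc
  have had : a + d = 2 := Nat.eq_of_mul_eq_mul_right hb (by linarith)
  have ha : a ≤ 2 := by omega
  obtain rfl : d = 2 - a := by omega
  have hbc : b * c ≤ 5 := by interval_cases a <;> omega
  have hb5 : b ≤ 5 := (Nat.le_mul_of_pos_right b hc).trans hbc
  have hc5 : c ≤ 5 := (Nat.le_mul_of_pos_left c hb).trans hbc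
  clear hN h01 had
  interval_cases a <;> interval_cases b <;> interval_cases c <;> simp_all
end
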